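/- arXiv:math/0604594 — 2 statements merged into one kernel-verified Lean document; each statement's English description precedes it below -/
import Mathlib

section
/- There exists a universal constant C > 0 with the following property. Let K ⊂ ℝⁿ be a centrally symmetric convex body of volume 1 which is 2-convex with constant α > 0, and suppose K is isotropic with isotropic constant L_K. Then L_K ≤ C/√α. -/
open MeasureTheory
open scoped RealInnerProductSpace

noncomputable section

/-- A centrally symmetric convex body: compact, convex, with nonempty interior,
and symmetric about the origin. -/
def IsSymmConvexBody {E : Type*} [NormedAddCommGroup E] [NormedSpace ℝ E]
    (K : Set E) : Prop :=
  IsCompact K ∧ Convex ℝ K ∧ (interior K).Nonempty ∧ K = -K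

/-- The modulus of convexity of `K`, defined via the gauge (Minkowski functional) of `K`. -/
def modulusOfConvexity {E : Type*} [AddCommGroup E] [Module ℝ E]
    (K : Set E) (ε : ℝ) : ℝ :=
  sInf { d | ∃ x y : E, gauge K x ≤ 1 ∧ gauge K y ≤ 1 ∧ ε ≤ gauge K (x - y) ∧
    d = 1 - gauge K ((2:ℝ)⁻¹ • (x + y)) }

/-- `K` is 2-convex with constant `α`: `δ_K(ε) ≥ α ε²` for all `0 < ε ≤ 2`. -/
def IsTwoConvex {E : Type*} [AddCommGroup E] [Module ℝ E]
    (K : Set E) (α : ℝ) : Prop :=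
  ∀ ε : ℝ, 0 < ε → ε ≤ 2 → α * ε ^ 2 ≤ modulusOfConvexity K ε

/-- `K` (of volume 1) is isotropic with isotropic constant `L`:
`∫_K ⟨x,θ⟩² dx = L² |θ|²` for every `θ`. -/
def IsIsotropic {n : ℕ} (K : Set (EuclideanSpace ℝ (Fin n))) (L : ℝ) : Prop :=
  0 < L ∧ ∀ θ : EuclideanSpace ℝ (Fin n),
    ∫ x in K, ⟪x, θ⟫ ^ 2 = L ^ 2 * ‖θ‖ ^ 2

namespace BrunnMinkowski

open Set
open scoped ENNReal

/-- One-dimensional Brunn–Minkowski for compact sets, in midpoint form. -/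
lemma volume_add_volume_le_of_isCompact {A B C : Set ℝ} (hA : IsCompact A) (hB : IsCompact B)
    (hA0 : A.Nonempty) (hB0 : B.Nonempty) (h : ∀ x ∈ A, ∀ y ∈ B, 2⁻¹ * (x + y) ∈ C) :
    volume A + volume B ≤ 2 * volume C := by
  set a := sSup A
  set b := sInf B
  have ha : a ∈ A := hA.sSup_mem hA0
  have hb : b ∈ B := hB.sInf_mem hB0
  have hvol (c : ℝ) (S : Set ℝ) : volume ((fun x => 2⁻¹ * (x + c)) ⁻¹' S) = 2 * volume S := by
    have : (fun x : ℝ => 2⁻¹ * (x + c)) ⁻¹' S = (fun x => x + c) ⁻¹' ((fun x => 2⁻¹ * x) ⁻¹' S) :=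
      rfl
    rw [this, measure_preimage_add_right, Real.volume_preimage_mul_left (by norm_num)]
    norm_num
  set m := 2⁻¹ * (a + b)
  have h1 : volume A ≤ 2 * volume (C ∩ Iic m) := by
    rw [← hvol b]
    refine measure_mono fun x hx => ⟨h x hx b hb, ?_⟩
    have : x ≤ a := le_csSup hA.bddAbove hx
    simp only [mem_Iic, m]; linarith
  have h2 : volume B ≤ 2 * volume (C \ Iic m) := by
    have h3 : volume (B \ {b}) = volume B := measure_sdiff_null (by simp)
    rw [← h3, ← hvol a]
    refine measure_mono fun y hy => ⟨?_, ?_⟩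
    · simpa [add_comm] using h a ha y hy.1
    · have h4 : b ≤ y := csInf_le hB.bddBelow hy.1
      have h5 : b < y := lt_of_le_of_ne h4 fun e => hy.2 (by simp [e])
      simp only [mem_Iic, m, not_le]; linarith
  calc volume A + volume B ≤ 2 * volume (C ∩ Iic m) + 2 * volume (C \ Iic m) := add_le_add h1 h2
    _ = 2 * volume C := by rw [← mul_add, measure_inter_add_sdiff _ measurableSet_Iic]

/-- One-dimensional Brunn–Minkowski for measurable sets, in midpoint form. -/
lemma volume_add_volume_le {A B C : Set ℝ} (hA : MeasurableSet A) (hB : MeasurableSet B)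
    (hA0 : A.Nonempty) (hB0 : B.Nonempty) (h : ∀ x ∈ A, ∀ y ∈ B, 2⁻¹ * (x + y) ∈ C) :
    volume A + volume B ≤ 2 * volume C := by
  obtain ⟨a, ha⟩ := hA0
  obtain ⟨b, hb⟩ := hB0
  have key : ∀ K ⊆ A, IsCompact K → ∀ L ⊆ B, IsCompact L →
      volume K + volume L ≤ 2 * volume C := fun K hKA hK L hLB hL =>
    (add_le_add (measure_mono (subset_insert a K)) (measure_mono (subset_insert b L))).trans <|
      volume_add_volume_le_of_isCompact (hK.insert a) (hL.insert b) ⟨a, by simp⟩ ⟨b, by simp⟩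
        fun x hx y hy => h x (insert_subset ha hKA hx) y (insert_subset hb hLB hy)
  rw [hA.measure_eq_iSup_isCompact, hB.measure_eq_iSup_isCompact]
  simp only [iSup_and']
  exact ENNReal.biSup_add_biSup_le' ⟨∅, empty_subset _, isCompact_empty⟩
    ⟨∅, empty_subset _, isCompact_empty⟩ fun K hK L hL => key K hK.1 hK.2 L hL.1 hL.2

lemma lintegral_eq_lintegral_volume_lt {u : ℝ → ℝ≥0∞} (hu : Measurable u) (hu1 : ∀ x, u x ≤ 1) :
    ∫⁻ x, u x = ∫⁻ t in Ioi (0 : ℝ), volume {x | ENNReal.ofReal t < u x} := by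
  have htop x : u x ≠ ∞ := ne_top_of_le_ne_top ENNReal.one_ne_top (hu1 x)
  have h := lintegral_eq_lintegral_meas_lt volume (f := fun x => (u x).toReal)
    (.of_forall fun x => ENNReal.toReal_nonneg) hu.ennreal_toReal.aemeasurable
  simp only [ENNReal.ofReal_toReal (htop _)] at h
  rw [h]
  refine setLIntegral_congr_fun measurableSet_Ioi fun t ht => ?_
  simp only [ENNReal.ofReal_lt_iff_lt_toReal (le_of_lt ht) (htop _)]

lemma lintegral_add_lintegral_le {f g h : ℝ → ℝ≥0∞} (hf : Measurable f) (hg : Measurable g)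
    (hh : Measurable h) (hf1 : ⨆ x, f x = 1) (hg1 : ⨆ x, g x = 1)
    (H : ∀ x y, f x * g y ≤ h (2⁻¹ * (x + y)) ^ 2) :
    (∫⁻ x, f x) + ∫⁻ x, g x ≤ 2 * ∫⁻ x, h x := by
  have hf1' x : f x ≤ 1 := hf1 ▸ le_iSup f x
  have hg1' x : g x ≤ 1 := hg1 ▸ le_iSup g x
  have hmin : Measurable fun x => min (h x) 1 := hh.min measurable_const
  calc (∫⁻ x, f x) + ∫⁻ x, g x ≤ 2 * ∫⁻ x, min (h x) 1 := ?_
    _ ≤ 2 * ∫⁻ x, h x := by gcongr; exact min_le_left _ _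
  rw [lintegral_eq_lintegral_volume_lt hf hf1', lintegral_eq_lintegral_volume_lt hg hg1',
    lintegral_eq_lintegral_volume_lt hmin fun x => min_le_right _ _,
    ← lintegral_const_mul' _ _ (by simp), ← lintegral_add_left]
  · refine setLIntegral_mono_ae' measurableSet_Ioi (.of_forall fun t _ => ?_)
    rcases lt_or_ge (ENNReal.ofReal t) 1 with ht1 | ht1
    · refine volume_add_volume_le (measurableSet_lt measurable_const hf)
        (measurableSet_lt measurable_const hg) (lt_iSup_iff.1 (ht1.trans_eq hf1.symm))
        (lt_iSup_iff.1 (ht1.trans_eq hg1.symm)) fun x hx y hy => ?_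
      refine lt_min ?_ ht1
      by_contra! hle
      have h1 : ENNReal.ofReal t * ENNReal.ofReal t < f x * g y := ENNReal.mul_lt_mul hx hy
      have h2 : h (2⁻¹ * (x + y)) ^ 2 ≤ ENNReal.ofReal t ^ 2 := by gcongr
      exact absurd (h1.trans_le ((H x y).trans h2)) (by simp [sq])
    · have e1 : {x | ENNReal.ofReal t < f x} = ∅ := by
        ext x; simpa using (hf1' x).trans ht1
      have e2 : {x | ENNReal.ofReal t < g x} = ∅ := by
        ext x; simpa using (hg1' x).trans ht1
      simp [e1, e2]
  · exact Antitone.measurable fun s t hst => measure_mono fun x hx =>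
      lt_of_le_of_lt (ENNReal.ofReal_le_ofReal hst) hx

lemma four_mul_le_add_sq (x y : ℝ≥0∞) : 4 * (x * y) ≤ (x + y) ^ 2 := by
  rcases eq_or_ne x ∞ with rfl | hx
  · simp
  rcases eq_or_ne y ∞ with rfl | hy
  · simp
  lift x to NNReal using hx
  lift y to NNReal using hy
  norm_cast
  rw [← NNReal.coe_le_coe]
  push_cast
  nlinarith [sq_nonneg ((x : ℝ) - y)]

lemma lintegral_mul_lintegral_le_of_iSup_ne_top {f g h : ℝ → ℝ≥0∞} (hf : Measurable f)
    (hg : Measurable g) (hh : Measurable h) (hf1 : ⨆ x, f x ≠ ∞) (hg1 : ⨆ x, g x ≠ ∞)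
    (H : ∀ x y, f x * g y ≤ h (2⁻¹ * (x + y)) ^ 2) :
    (∫⁻ x, f x) * ∫⁻ x, g x ≤ (∫⁻ x, h x) ^ 2 := by
  set a := ⨆ x, f x with ha
  set b := ⨆ x, g x with hb
  rcases eq_or_ne a 0 with ha0 | ha0
  · have : f = 0 := by ext x; simpa [← ha, ha0] using le_iSup f x
    simp [this]
  rcases eq_or_ne b 0 with hb0 | hb0
  · have : g = 0 := by ext x; simpa [← hb, hb0] using le_iSup g x
    simp [this]
  obtain ⟨c, hc⟩ : ∃ c : ℝ≥0∞, c ^ 2 = a * b := ⟨(a * b) ^ (2⁻¹ : ℝ), by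
    rw [← ENNReal.rpow_natCast, ← ENNReal.rpow_mul]; simp⟩
  have hab0 : a * b ≠ 0 := mul_ne_zero ha0 hb0
  have habt : a * b ≠ ∞ := ENNReal.mul_ne_top hf1 hg1
  have hinv : (c⁻¹) ^ 2 = a⁻¹ * b⁻¹ := by
    rw [← ENNReal.inv_pow, hc, ENNReal.mul_inv (.inl ha0) (.inl hf1)]
  have key := lintegral_add_lintegral_le (f := fun x => a⁻¹ * f x) (g := fun x => b⁻¹ * g x)
    (h := fun x => c⁻¹ * h x) (hf.const_mul _) (hg.const_mul _) (hh.const_mul _)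
    (by rw [← ENNReal.mul_iSup, ← ha, ENNReal.inv_mul_cancel ha0 hf1])
    (by rw [← ENNReal.mul_iSup, ← hb, ENNReal.inv_mul_cancel hb0 hg1])
    (fun x y => by
      rw [mul_pow, hinv, mul_mul_mul_comm]
      gcongr
      exact H x y)
  rw [lintegral_const_mul _ hf, lintegral_const_mul _ hg, lintegral_const_mul _ hh] at key
  set I := ∫⁻ x, f x
  set J := ∫⁻ x, g x
  set S := ∫⁻ x, h x
  have h4 : 4 * ((a * b)⁻¹ * (I * J)) ≤ 4 * ((a * b)⁻¹ * S ^ 2) := by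
    calc 4 * ((a * b)⁻¹ * (I * J)) = 4 * ((a⁻¹ * I) * (b⁻¹ * J)) := by
          rw [ENNReal.mul_inv (.inl ha0) (.inl hf1), mul_mul_mul_comm]
      _ ≤ (a⁻¹ * I + b⁻¹ * J) ^ 2 := four_mul_le_add_sq _ _
      _ ≤ (2 * (c⁻¹ * S)) ^ 2 := by gcongr
      _ = 4 * ((a * b)⁻¹ * S ^ 2) := by
          rw [mul_pow, mul_pow, hinv, ENNReal.mul_inv (.inl ha0) (.inl hf1)]; norm_num
  rw [ENNReal.mul_le_mul_iff_right (by norm_num) (by norm_num),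
    ENNReal.mul_le_mul_iff_right (by simpa using habt) (by simpa using hab0)] at h4
  exact h4

/-- The one-dimensional Prékopa–Leindler inequality with weights `1/2`. -/
theorem lintegral_mul_lintegral_le {f g h : ℝ → ℝ≥0∞} (hf : Measurable f)
    (hg : Measurable g) (hh : Measurable h)
    (H : ∀ x y, f x * g y ≤ h (2⁻¹ * (x + y)) ^ 2) :
    (∫⁻ x, f x) * ∫⁻ x, g x ≤ (∫⁻ x, h x) ^ 2 := by
  have trunc {u : ℝ → ℝ≥0∞} (hu : Measurable u) :
      ∫⁻ x, u x = ⨆ N : ℕ, ∫⁻ x, min (u x) N := by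
    rw [← lintegral_iSup (fun N => hu.min measurable_const)
      fun M N hMN x => min_le_min_left _ (by exact_mod_cast hMN)]
    congr with x
    rw [← inf_iSup_eq, ENNReal.iSup_natCast, inf_top_eq]
  have bdd (u : ℝ → ℝ≥0∞) (N : ℕ) : ⨆ x, min (u x) N ≠ ∞ :=
    ne_top_of_le_ne_top (ENNReal.natCast_ne_top N) (iSup_le fun x => min_le_right _ _)
  rw [trunc hf, trunc hg, ENNReal.iSup_mul]
  refine iSup_le fun M => ?_
  rw [ENNReal.mul_iSup]
  exact iSup_le fun N => lintegral_mul_lintegral_le_of_iSup_ne_top (hf.min measurable_const)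
    (hg.min measurable_const) hh (bdd f M) (bdd g N) fun x y =>
      (mul_le_mul' (min_le_left _ _) (min_le_left _ _)).trans (H x y)

/-- The multiplicative Brunn–Minkowski inequality for coordinate space. -/
theorem volume_mul_volume_le_pi (n : ℕ) {A B C : Set (Fin n → ℝ)} (hA : MeasurableSet A)
    (hB : MeasurableSet B) (hC : MeasurableSet C)
    (h : ∀ x ∈ A, ∀ y ∈ B, (2⁻¹ : ℝ) • (x + y) ∈ C) :
    volume A * volume B ≤ volume C ^ 2 := by
  induction n with
  | zero =>
    rcases A.eq_empty_or_nonempty with rfl | ⟨a, ha⟩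
    · simp
    rcases B.eq_empty_or_nonempty with rfl | ⟨b, hb⟩
    · simp
    have hA' : A = univ := Subsingleton.eq_univ_of_nonempty ⟨a, ha⟩
    have hB' : B = univ := Subsingleton.eq_univ_of_nonempty ⟨b, hb⟩
    have hC' : C = univ := Subsingleton.eq_univ_of_nonempty ⟨_, h a ha b hb⟩
    simp [hA', hB', hC', sq]
  | succ n ih =>
    have slice {S : Set (Fin (n + 1) → ℝ)} (hS : MeasurableSet S) :
        (∀ t : ℝ, MeasurableSet {y : Fin n → ℝ | Fin.cons t y ∈ S}) ∧
        Measurable (fun t : ℝ => volume {y : Fin n → ℝ | (Fin.cons t y : Fin (n + 1) → ℝ) ∈ S}) ∧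
        volume S = ∫⁻ t : ℝ, volume {y : Fin n → ℝ | (Fin.cons t y : Fin (n + 1) → ℝ) ∈ S} := by
      have e := (volume_preserving_piFinSuccAbove (fun _ : Fin (n + 1) => ℝ) 0).symm
      have hm := e.measurable hS
      have hset (t : ℝ) : Prod.mk t ⁻¹' ((MeasurableEquiv.piFinSuccAbove
          (fun _ : Fin (n + 1) => ℝ) 0).symm ⁻¹' S) =
          {y : Fin n → ℝ | (Fin.cons t y : Fin (n + 1) → ℝ) ∈ S} := by
        ext y
        simp [MeasurableEquiv.piFinSuccAbove_symm_apply, Fin.insertNthEquiv]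
      refine ⟨fun t => ?_, ?_, ?_⟩
      · rw [← hset]; exact measurable_prodMk_left hm
      · simp only [← hset]; exact measurable_measure_prodMk_left hm
      · simp only [← hset]
        rw [← e.measure_preimage hS.nullMeasurableSet]
        exact Measure.prod_apply hm
    obtain ⟨hA1, hA2, hA3⟩ := slice hA
    obtain ⟨hB1, hB2, hB3⟩ := slice hB
    obtain ⟨hC1, hC2, hC3⟩ := slice hC
    rw [hA3, hB3, hC3]
    refine lintegral_mul_lintegral_le hA2 hB2 hC2 fun s t => ih (hA1 s) (hB1 t) (hC1 _) ?_
    intro x hx y hy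
    have h1 := h _ hx _ hy
    have h2 : (2⁻¹ : ℝ) • ((Fin.cons s x : Fin (n + 1) → ℝ) + Fin.cons t y) =
        Fin.cons (2⁻¹ * (s + t)) ((2⁻¹ : ℝ) • (x + y)) := by
      ext i
      refine Fin.cases ?_ (fun j => ?_) i <;> simp [mul_add]
    rwa [h2] at h1

/-- The multiplicative Brunn–Minkowski inequality in Euclidean space. -/
theorem volume_mul_volume_le {n : ℕ} {A B C : Set (EuclideanSpace ℝ (Fin n))}
    (hA : MeasurableSet A) (hB : MeasurableSet B) (hC : MeasurableSet C)
    (h : ∀ x ∈ A, ∀ y ∈ B, (2⁻¹ : ℝ) • (x + y) ∈ C) :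
    volume A * volume B ≤ volume C ^ 2 := by
  have e := PiLp.volume_preserving_toLp (Fin n)
  rw [← e.measure_preimage hA.nullMeasurableSet, ← e.measure_preimage hB.nullMeasurableSet,
    ← e.measure_preimage hC.nullMeasurableSet]
  exact volume_mul_volume_le_pi n (e.measurable hA) (e.measurable hB) (e.measurable hC)
    fun x hx y hy => h _ hx _ hy

end BrunnMinkowski

section ConvexBody

open Set
open scoped Pointwise ENNReal Topology

variable {E : Type*} [NormedAddCommGroup E] [NormedSpace ℝ E] {K : Set E}

lemma IsSymmConvexBody.mem_nhds_zero (hK : IsSymmConvexBody K) : K ∈ 𝓝 (0 : E) := by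
  obtain ⟨-, hconv, ⟨x, hx⟩, hsymm⟩ := hK
  have hx' : -x ∈ interior K := by
    rw [hsymm]
    have : interior (-K) = -interior K := ((Homeomorph.neg E).preimage_interior K).symm
    rw [this]
    simpa using hx
  rw [← mem_interior_iff_mem_nhds]
  have h0 := hconv.interior hx hx' (a := 2⁻¹) (b := 2⁻¹) (by norm_num) (by norm_num) (by norm_num)
  simpa using h0

lemma IsSymmConvexBody.gauge_le_one_iff (hK : IsSymmConvexBody K) {x : E} :
    gauge K x ≤ 1 ↔ x ∈ K := by
  rw [gauge_le_one_iff_mem_closure hK.2.1 hK.mem_nhds_zero, hK.1.isClosed.closure_eq]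

lemma IsSymmConvexBody.neg_mem (hK : IsSymmConvexBody K) {x : E} (hx : x ∈ K) : -x ∈ K := by
  rw [hK.2.2.2]
  simpa using hx

lemma IsSymmConvexBody.mem_smul_of_gauge_le (hK : IsSymmConvexBody K) {c : ℝ} {x : E}
    (hx : gauge K x ≤ c) : x ∈ c • K := by
  rcases ((gauge_nonneg x).trans hx).eq_or_lt with rfl | hc
  · have h0 : x = 0 := (gauge_eq_zero (absorbent_nhds_zero hK.mem_nhds_zero)
      (NormedSpace.isVonNBounded_iff ℝ |>.2 hK.1.isBounded)).1 (hx.antisymm (gauge_nonneg x))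
    exact ⟨0, mem_of_mem_nhds hK.mem_nhds_zero, by simp [h0]⟩
  · rw [mem_smul_set_iff_inv_smul_mem₀ hc.ne', ← hK.gauge_le_one_iff,
      gauge_smul_of_nonneg (inv_nonneg.2 hc.le), smul_eq_mul, inv_mul_le_iff₀ hc, mul_one]
    exact hx

lemma IsSymmConvexBody.le_mul_gauge (hK : IsSymmConvexBody K) {φ : E →L[ℝ] ℝ} {M : ℝ}
    (hφ : ∀ x ∈ K, φ x ≤ M) (x : E) : φ x ≤ M * gauge K x := by
  obtain ⟨y, hy, hxy⟩ := hK.mem_smul_of_gauge_le (le_refl (gauge K x))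
  calc φ x = gauge K x * φ y := by rw [← smul_eq_mul, ← map_smul]; exact congrArg φ hxy.symm
    _ ≤ gauge K x * M := mul_le_mul_of_nonneg_left (hφ y hy) (gauge_nonneg x)
    _ = M * gauge K x := mul_comm _ _

lemma IsTwoConvex.gauge_midpoint_le (hK : IsSymmConvexBody K) {α : ℝ} (h2 : IsTwoConvex K α)
    {x y : E} (hx : x ∈ K) (hy : y ∈ K) {ε : ℝ} (hε : 0 < ε) (hε2 : ε ≤ 2)
    (hxy : ε ≤ gauge K (x - y)) : gauge K ((2 : ℝ)⁻¹ • (x + y)) ≤ 1 - α * ε ^ 2 := by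
  have hb : BddBelow { d | ∃ x y : E, gauge K x ≤ 1 ∧ gauge K y ≤ 1 ∧ ε ≤ gauge K (x - y) ∧
      d = 1 - gauge K ((2 : ℝ)⁻¹ • (x + y)) } := by
    refine ⟨0, ?_⟩
    rintro _ ⟨u, v, hu, hv, -, rfl⟩
    have := gauge_add_le hK.2.1 (absorbent_nhds_zero hK.mem_nhds_zero) u v
    rw [gauge_smul_of_nonneg (by norm_num : (0 : ℝ) ≤ 2⁻¹), smul_eq_mul]
    linarith
  have h3 := (h2 ε hε hε2).trans (csInf_le hb
    ⟨x, y, gauge_le_one_of_mem hx, gauge_le_one_of_mem hy, hxy, rfl⟩)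
  linarith

end ConvexBody

section Concentration

open Set
open scoped Pointwise ENNReal

variable {n : ℕ} {K : Set (EuclideanSpace ℝ (Fin n))} {α M : ℝ}
  {φ : EuclideanSpace ℝ (Fin n) →L[ℝ] ℝ}

/-- Gaussian concentration of linear functionals on a 2-convex body. -/
lemma IsTwoConvex.volume_superlevel_le (hK : IsSymmConvexBody K) (hvol : volume K = 1)
    (h2 : IsTwoConvex K α) (hM : 0 < M) (hφ : ∀ x ∈ K, φ x ≤ M) {t : ℝ} (ht : 0 < t) :
    volume {x ∈ K | t ≤ φ x} ≤
      ENNReal.ofReal (Real.exp (-(4 * n * α / M ^ 2) * t ^ 2)) := by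
  set A := {x ∈ K | t ≤ φ x} with hA
  rcases A.eq_empty_or_nonempty with he | ⟨z, hz⟩
  · simp [he]
  have hAm : MeasurableSet A := hK.1.measurableSet.inter
    (measurableSet_le measurable_const φ.continuous.measurable)
  set ε := 2 * t / M with hε
  have hε0 : 0 < ε := by positivity
  have hε2 : ε ≤ 2 := by
    rw [hε, div_le_iff₀ hM]; linarith [hz.2.trans (hφ z hz.1)]
  set c := 1 - α * ε ^ 2 with hc
  have hmid : ∀ x ∈ A, ∀ y ∈ -A, gauge K ((2 : ℝ)⁻¹ • (x + y)) ≤ c := by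
    intro x hx y hy
    refine h2.gauge_midpoint_le hK hx.1 ?_ hε0 hε2 ?_
    · simpa using hK.neg_mem hy.1
    · have h3 := hK.le_mul_gauge hφ (x - y)
      have h4 : t ≤ φ (-y) := hy.2
      rw [map_neg] at h4
      rw [map_sub] at h3
      rw [hε, div_le_iff₀ hM]
      linarith [hx.2]
  have hc0 : 0 ≤ c := (gauge_nonneg _).trans (hmid z hz (-z) (by simpa using hz))
  have hbm := BrunnMinkowski.volume_mul_volume_le hAm hAm.neg (hK.1.smul c).measurableSet
    fun x hx y hy => hK.mem_smul_of_gauge_le (hmid x hx y hy)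
  rw [Measure.measure_neg, ← sq] at hbm
  refine ((ENNReal.pow_le_pow_left_iff two_ne_zero).1 hbm).trans ?_
  rw [Measure.addHaar_smul, hvol, mul_one, finrank_euclideanSpace_fin, abs_of_nonneg (by positivity)]
  refine ENNReal.ofReal_le_ofReal ?_
  calc c ^ n ≤ Real.exp (-(α * ε ^ 2)) ^ n := by
        gcongr
        exact Real.one_sub_le_exp_neg _
    _ = Real.exp (-(4 * n * α / M ^ 2) * t ^ 2) := by
        rw [← Real.exp_nat_mul, hε]
        congr 1
        field_simp
        ring

lemma lintegral_exp_neg_mul_Ioi {b : ℝ} (hb : 0 < b) :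
    ∫⁻ s in Ioi (0 : ℝ), ENNReal.ofReal (Real.exp (-b * s)) = ENNReal.ofReal b⁻¹ := by
  rw [← ofReal_integral_eq_lintegral_ofReal (integrableOn_exp_mul_Ioi (by linarith) 0)
    (.of_forall fun s => (Real.exp_pos _).le), integral_exp_mul_Ioi (by linarith)]
  simp

lemma IsTwoConvex.integral_sq_le (hn : 0 < n) (hK : IsSymmConvexBody K) (hvol : volume K = 1)
    (hα : 0 < α) (h2 : IsTwoConvex K α) (hM : 0 < M) (hφ : ∀ x ∈ K, φ x ≤ M) :
    ∫ x in K, φ x ^ 2 ≤ M ^ 2 / (2 * n * α) := by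
  set b := 4 * n * α / M ^ 2 with hb
  have hb0 : 0 < b := by positivity
  have hφ' : ∀ x ∈ K, (-φ) x ≤ M := fun x hx => by simpa using hφ _ (hK.neg_mem hx)
  have htail : ∀ s ∈ Ioi (0 : ℝ), (volume.restrict K) {x | s < φ x ^ 2} ≤
      2 * ENNReal.ofReal (Real.exp (-b * s)) := by
    intro s hs
    have hs' : 0 < √s := Real.sqrt_pos.2 hs
    rw [Measure.restrict_apply
      (measurableSet_lt measurable_const (by fun_prop : Measurable fun x => φ x ^ 2))]
    have h3 := h2.volume_superlevel_le hK hvol hM hφ hs'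
    have h4 := h2.volume_superlevel_le hK hvol hM hφ' hs'
    rw [Real.sq_sqrt (le_of_lt hs)] at h3 h4
    calc volume ({x | s < φ x ^ 2} ∩ K)
        ≤ volume ({x ∈ K | √s ≤ φ x} ∪ {x ∈ K | √s ≤ (-φ) x}) := by
          refine measure_mono fun x hx => ?_
          have h5 : √s < |φ x| := by
            rw [← Real.sqrt_sq_eq_abs]; exact Real.sqrt_lt_sqrt (le_of_lt hs) hx.1
          rcases lt_abs.1 h5 with h6 | h6
          · exact .inl ⟨hx.2, h6.le⟩
          · exact .inr ⟨hx.2, h6.le⟩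
      _ ≤ _ := measure_union_le _ _
      _ ≤ _ := add_le_add h3 h4
      _ = _ := (two_mul _).symm
  rw [integral_eq_lintegral_of_nonneg_ae (.of_forall fun x => sq_nonneg _)
    (φ.continuous.pow 2).aestronglyMeasurable]
  refine ENNReal.toReal_le_of_le_ofReal (by positivity) ?_
  rw [lintegral_eq_lintegral_meas_lt _ (.of_forall fun x => sq_nonneg _)
    (φ.continuous.pow 2).aemeasurable]
  calc _ ≤ ∫⁻ s in Ioi (0 : ℝ), 2 * ENNReal.ofReal (Real.exp (-b * s)) :=
        setLIntegral_mono_ae' measurableSet_Ioi (.of_forall htail)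
    _ = 2 * ENNReal.ofReal b⁻¹ := by
        rw [lintegral_const_mul' _ _ (by simp), lintegral_exp_neg_mul_Ioi hb0]
    _ = ENNReal.ofReal (M ^ 2 / (2 * n * α)) := by
        rw [← ENNReal.ofReal_ofNat, ← ENNReal.ofReal_mul (by norm_num), hb]
        congr 1
        field_simp
        norm_num

/-- An isotropic 2-convex body contains a ball of radius `√(2 n α) L`. -/
lemma IsTwoConvex.mem_of_norm_sq_le {L : ℝ} (hn : 0 < n) (hK : IsSymmConvexBody K)
    (hvol : volume K = 1) (hα : 0 < α) (h2 : IsTwoConvex K α) (hL : IsIsotropic K L)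
    {x : EuclideanSpace ℝ (Fin n)} (hx : ‖x‖ ^ 2 ≤ 2 * n * α * L ^ 2) : x ∈ K := by
  by_contra hxK
  obtain ⟨f, u, hfu, hux⟩ := geometric_hahn_banach_closed_point hK.2.1 hK.1.isClosed hxK
  have hu : 0 < u := by simpa using hfu 0 (mem_of_mem_nhds hK.mem_nhds_zero)
  have h3 := h2.integral_sq_le hn hK hvol hα hu fun a ha => (hfu a ha).le
  set θ := (InnerProductSpace.toDual ℝ _).symm f with hθ
  have hf y : f y = ⟪y, θ⟫ := by
    rw [real_inner_comm, hθ, InnerProductSpace.toDual_symm_apply]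
  simp only [hf, hL.2] at h3
  rw [le_div_iff₀ (by positivity)] at h3
  rw [hf] at hux
  have h4 : ⟪x, θ⟫ ≤ ‖x‖ * ‖θ‖ := real_inner_le_norm x θ
  have h5 : u ^ 2 < (‖x‖ * ‖θ‖) ^ 2 := by gcongr; linarith
  have h6 : ‖x‖ ^ 2 * ‖θ‖ ^ 2 ≤ 2 * n * α * L ^ 2 * ‖θ‖ ^ 2 := by gcongr
  linarith [mul_pow ‖x‖ ‖θ‖ 2]

end Concentration

theorem twoConvex_isotropic_constant_bound :
    ∃ C : ℝ, 0 < C ∧ ∀ (n : ℕ) (K : Set (EuclideanSpace ℝ (Fin n))) (α L : ℝ),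
      0 < n → IsSymmConvexBody K → volume K = 1 → 0 < α → IsTwoConvex K α →
      IsIsotropic K L →
      L ≤ C / Real.sqrt α := by
  refine ⟨1, one_pos, fun n K α L hn hK hvol hα h2 hL => ?_⟩
  have hL0 := hL.1
  set r := √(2 * α) * L with hr
  have hr0 : 0 ≤ r := by positivity
  have hr2 : r ^ 2 = 2 * α * L ^ 2 := by rw [hr, mul_pow, Real.sq_sqrt (by positivity)]
  have hcube : Set.Icc (fun _ : Fin n => -r) (fun _ => r) ⊆ WithLp.toLp 2 ⁻¹' K := by
    intro x hx
    refine h2.mem_of_norm_sq_le hn hK hvol hα hL ?_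
    rw [EuclideanSpace.norm_sq_eq]
    calc ∑ i, ‖x i‖ ^ 2 ≤ ∑ _i : Fin n, r ^ 2 := by
          refine Finset.sum_le_sum fun i _ => ?_
          gcongr
          exact abs_le.2 ⟨hx.1 i, hx.2 i⟩
      _ = 2 * n * α * L ^ 2 := by simp [hr2]; ring
  have hv := measure_mono (μ := volume) hcube
  rw [(PiLp.volume_preserving_toLp (Fin n)).measure_preimage
    hK.1.measurableSet.nullMeasurableSet, hvol, Real.volume_Icc_pi] at hv
  simp only [Finset.prod_const, Finset.card_univ, Fintype.card_fin, sub_neg_eq_add] at hv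
  have h3 : r + r ≤ 1 := by
    rw [← ENNReal.ofReal_le_one]
    exact (pow_le_one_iff hn.ne').1 hv
  have h4 : √α ≤ √(2 * α) := Real.sqrt_le_sqrt (by linarith)
  rw [le_div_iff₀ (Real.sqrt_pos.2 hα)]
  nlinarith
end
end

section
/- There exist universal constants C₁, C₂ > 0 with the following property. Let K ⊂ ℝⁿ be a centrally symmetric convex body which is 2-convex with constant α > 0. Then for every unit vector θ ∈ S^{n−1}: C₁·‖θ‖*_K/√n ≤ ‖⟨·,θ⟩‖_{ψ₂(K)} ≤ C₂·‖θ‖*_K/(√α·√n). -/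
open MeasureTheory
open scoped RealInnerProductSpace

noncomputable section

/-- The dual norm `‖θ‖*_K = sup_{y ∈ K} ⟨θ, y⟩`. -/
def dualNorm {n : ℕ} (K : Set (EuclideanSpace ℝ (Fin n)))
    (θ : EuclideanSpace ℝ (Fin n)) : ℝ :=
  sSup ((fun y => ⟪θ, y⟫) '' K)

/-- The `ψ₂`-norm of the linear functional `⟨·, θ⟩` w.r.t. the uniform measure on `K`:
`inf { λ > 0 : (1/|K|) ∫_K exp(⟨x,θ⟩²/λ²) dx ≤ 2 }`. -/
def psiTwoNorm {n : ℕ} (K : Set (EuclideanSpace ℝ (Fin n)))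
    (θ : EuclideanSpace ℝ (Fin n)) : ℝ :=
  sInf { l : ℝ | 0 < l ∧
    (volume K).toReal⁻¹ * ∫ x in K, Real.exp (⟪x, θ⟫ ^ 2 / l ^ 2) ≤ 2 }

open scoped ENNReal Topology Pointwise

lemma volume_add_le_two_mul_of_midpoint_mem {A B C : Set ℝ} (hA : MeasurableSet A)
    (hB : MeasurableSet B) (hA₀ : A.Nonempty) (hB₀ : B.Nonempty)
    (h : ∀ a ∈ A, ∀ b ∈ B, (2:ℝ)⁻¹ * (a + b) ∈ C) :
    volume A + volume B ≤ 2 * volume C := by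
  have hC : volume ((fun c : ℝ => (2:ℝ)⁻¹ * c) ⁻¹' C) = 2 * volume C := by
    rw [Real.volume_preimage_mul_left (by norm_num)]
    simp
  rw [← hC]
  by_cases hAz : volume A = 0
  · obtain ⟨a, ha⟩ := hA₀
    rw [hAz, zero_add, ← measure_preimage_add_right volume (-a) B]
    refine measure_mono fun x hx => ?_
    have := h a ha _ hx
    simpa using this
  by_cases hBz : volume B = 0
  · obtain ⟨b, hb⟩ := hB₀
    rw [hBz, add_zero, ← measure_preimage_add_right volume (-b) A]
    refine measure_mono fun x hx => ?_
    have := h _ hx b hb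
    simpa using this
  refine le_of_forall_lt fun c hc => ?_
  obtain ⟨r, hr, s, hs, hcrs⟩ := ENNReal.exists_lt_add_of_lt_add hc hAz hBz
  obtain ⟨A', hA'A, hA'c, hrA'⟩ := hA.exists_lt_isCompact hr
  obtain ⟨B', hB'B, hB'c, hsB'⟩ := hB.exists_lt_isCompact hs
  have hA'₀ : A'.Nonempty := nonempty_of_measure_ne_zero (ne_bot_of_gt hrA')
  have hB'₀ : B'.Nonempty := nonempty_of_measure_ne_zero (ne_bot_of_gt hsB')
  obtain ⟨a, haA, ha⟩ := hA'c.exists_isGreatest hA'₀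
  obtain ⟨b, hbB, hb⟩ := hB'c.exists_isLeast hB'₀
  refine (hcrs.trans_le (add_le_add hrA'.le hsB'.le)).trans_le ?_
  rw [← measure_preimage_add_right volume (-b) A', ← measure_preimage_add_right volume (-a) B',
    ← measure_union₀]
  · refine measure_mono ?_
    rintro x (hx | hx)
    · have := h _ (hA'A hx) b (hB'B hbB)
      simpa using this
    · have := h a (hA'A haA) _ (hB'B hx)
      simpa using this
  · exact (measurable_add_const (-a) hB'c.measurableSet).nullMeasurableSet
  · refine measure_mono_null (t := {a + b}) ?_ (by simp)
    rintro x ⟨hx, hx'⟩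
    have h1 := ha hx
    have h2 := hb hx'
    simp only [Set.mem_singleton_iff]
    linarith

lemma ENNReal.mul_le_sq_of_add_le_two_mul {a b c : ℝ≥0∞} (h : a + b ≤ 2 * c) :
    a * b ≤ c ^ 2 := by
  by_cases hc : c = ⊤
  · simp [hc]
  have hab : a + b ≠ ⊤ := ne_top_of_le_ne_top (by finiteness) h
  obtain ⟨ha, hb⟩ := ENNReal.add_ne_top.1 hab
  lift a to NNReal using ha
  lift b to NNReal using hb
  lift c to NNReal using hc
  norm_cast at h ⊢
  have h' : (a:ℝ) + b ≤ 2 * c := by exact_mod_cast h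
  have : (a:ℝ) * b ≤ c ^ 2 := by
    nlinarith [sq_nonneg ((a:ℝ) - b), a.2, b.2, c.2,
      mul_self_le_mul_self (add_nonneg a.2 b.2) h']
  exact_mod_cast this

lemma lintegral_eq_lintegral_meas_ofReal_lt {X : Type*} [MeasurableSpace X] (μ : Measure X)
    {f : X → ℝ≥0∞} (hf : Measurable f) (hf_top : ∀ x, f x ≠ ⊤) :
    ∫⁻ x, f x ∂μ = ∫⁻ t in Set.Ioi (0:ℝ), μ {x | ENNReal.ofReal t < f x} := by
  have h := lintegral_eq_lintegral_meas_lt μ (f := fun x => (f x).toReal)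
    (Filter.Eventually.of_forall fun _ => ENNReal.toReal_nonneg) hf.ennreal_toReal.aemeasurable
  simp only [ENNReal.ofReal_toReal (hf_top _)] at h
  rw [h]
  refine setLIntegral_congr_fun measurableSet_Ioi fun t ht => ?_
  simp only [ENNReal.ofReal_lt_iff_lt_toReal (le_of_lt ht) (hf_top _)]

/-- The midpoint case of the Prékopa–Leindler inequality for the measure `μ`. -/
def SatisfiesPrekopaLeindler {E : Type*} [AddCommGroup E] [Module ℝ E] [MeasurableSpace E]
    (μ : Measure E) : Prop :=
  ∀ f g h : E → ℝ≥0∞, Measurable f → Measurable g → Measurable h →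
    (∀ x y, f x * g y ≤ h ((2:ℝ)⁻¹ • (x + y)) ^ 2) →
    (∫⁻ x, f x ∂μ) * ∫⁻ x, g x ∂μ ≤ (∫⁻ x, h x ∂μ) ^ 2

lemma lintegral_mul_le_sq_of_iSup_eq_one {f g h : ℝ → ℝ≥0∞} (hf : Measurable f)
    (hg : Measurable g) (hh : Measurable h) (hf₁ : ⨆ x, f x = 1) (hg₁ : ⨆ x, g x = 1)
    (H : ∀ x y, f x * g y ≤ h ((2:ℝ)⁻¹ • (x + y)) ^ 2) :
    (∫⁻ x, f x) * ∫⁻ x, g x ≤ (∫⁻ x, h x) ^ 2 := by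
  have hfle : ∀ x, f x ≤ 1 := fun x => hf₁ ▸ le_iSup f x
  have hgle : ∀ x, g x ≤ 1 := fun x => hg₁ ▸ le_iSup g x
  have hmin : ∫⁻ x, min (h x) 1 ≤ ∫⁻ x, h x := lintegral_mono fun x => min_le_left _ _
  have hftop : ∀ x, f x ≠ ⊤ := fun x => ne_top_of_le_ne_top ENNReal.one_ne_top (hfle x)
  have hgtop : ∀ x, g x ≠ ⊤ := fun x => ne_top_of_le_ne_top ENNReal.one_ne_top (hgle x)
  refine (ENNReal.mul_le_sq_of_add_le_two_mul ?_).trans (pow_le_pow_left' hmin 2)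
  have hmeas : ∀ k : ℝ → ℝ≥0∞, Measurable fun t : ℝ => volume {x | ENNReal.ofReal t < k x} := by
    intro k
    refine Antitone.measurable fun s t hst => measure_mono fun x hx => ?_
    exact (ENNReal.ofReal_le_ofReal hst).trans_lt hx
  rw [lintegral_eq_lintegral_meas_ofReal_lt _ hf hftop,
    lintegral_eq_lintegral_meas_ofReal_lt _ hg hgtop,
    lintegral_eq_lintegral_meas_ofReal_lt _ (hh.min measurable_const)
      (fun x => ne_top_of_le_ne_top ENNReal.one_ne_top (min_le_right _ _)),
    ← lintegral_add_left (hmeas f), ← lintegral_const_mul _ (hmeas _)]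
  refine setLIntegral_mono' measurableSet_Ioi fun t ht => ?_
  rcases lt_or_ge (ENNReal.ofReal t) 1 with ht1 | ht1
  · refine volume_add_le_two_mul_of_midpoint_mem (hf measurableSet_Ioi) (hg measurableSet_Ioi)
      ?_ ?_ ?_
    · rw [← hf₁] at ht1
      exact lt_iSup_iff.1 ht1
    · rw [← hg₁] at ht1
      exact lt_iSup_iff.1 ht1
    · intro a ha b hb
      refine lt_min ?_ ht1
      have h1 : ENNReal.ofReal t ^ 2 < h ((2:ℝ)⁻¹ • (a + b)) ^ 2 := by
        refine lt_of_lt_of_le ?_ (H a b)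
        rw [sq]
        exact ENNReal.mul_lt_mul ha hb
      exact lt_of_pow_lt_pow_left' 2 h1
  · have e1 : {x | ENNReal.ofReal t < f x} = ∅ := by
      ext x; simpa using (hfle x).trans ht1
    have e2 : {x | ENNReal.ofReal t < g x} = ∅ := by
      ext x; simpa using (hgle x).trans ht1
    simp [e1, e2]

lemma lintegral_mul_le_sq_of_iSup_ne_top {f g h : ℝ → ℝ≥0∞} (hf : Measurable f)
    (hg : Measurable g) (hh : Measurable h) (hf₁ : ⨆ x, f x ≠ ⊤) (hg₁ : ⨆ x, g x ≠ ⊤)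
    (H : ∀ x y, f x * g y ≤ h ((2:ℝ)⁻¹ • (x + y)) ^ 2) :
    (∫⁻ x, f x) * ∫⁻ x, g x ≤ (∫⁻ x, h x) ^ 2 := by
  set a := ⨆ x, f x with ha
  set b := ⨆ x, g x with hb
  by_cases ha0 : a = 0
  · have : ∀ x, f x = 0 := by simpa [ha] using ha0
    simp [this]
  by_cases hb0 : b = 0
  · have : ∀ x, g x = 0 := by simpa [hb] using hb0
    simp [this]
  have hab : a * b ≠ ⊤ := ENNReal.mul_ne_top hf₁ hg₁
  have hab0 : a * b ≠ 0 := mul_ne_zero ha0 hb0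
  set s : ℝ≥0∞ := (a * b) ^ (2⁻¹ : ℝ) with hs
  have hs2 : s ^ 2 = a * b := by
    rw [hs, ← ENNReal.rpow_natCast, ← ENNReal.rpow_mul]; simp
  have key := lintegral_mul_le_sq_of_iSup_eq_one (f := fun x => a⁻¹ * f x)
    (g := fun x => b⁻¹ * g x) (h := fun x => s⁻¹ * h x) (hf.const_mul _) (hg.const_mul _)
    (hh.const_mul _) (by rw [← ENNReal.mul_iSup, ← ha, ENNReal.inv_mul_cancel ha0 hf₁])
    (by rw [← ENNReal.mul_iSup, ← hb, ENNReal.inv_mul_cancel hb0 hg₁]) (by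
      intro x y
      rw [mul_pow, ← ENNReal.inv_pow, hs2, ENNReal.mul_inv (Or.inl ha0) (Or.inl hf₁),
        mul_mul_mul_comm]
      gcongr
      exact H x y)
  rw [lintegral_const_mul _ hf, lintegral_const_mul _ hg, lintegral_const_mul _ hh, mul_pow,
    ← ENNReal.inv_pow, hs2, mul_mul_mul_comm,
    ← ENNReal.mul_inv (Or.inl ha0) (Or.inl hf₁)] at key
  exact (ENNReal.mul_le_mul_iff_right (ENNReal.inv_ne_zero.2 hab) (ENNReal.inv_ne_top.2 hab0)).1 key

lemma iSup_min_natCast (a : ℝ≥0∞) : ⨆ k : ℕ, min a (k : ℝ≥0∞) = a := by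
  rw [← inf_iSup_eq, ENNReal.iSup_natCast, inf_top_eq]

theorem satisfiesPrekopaLeindler_real : SatisfiesPrekopaLeindler (volume : Measure ℝ) := by
  intro f g h hf hg hh H
  have hint : ∀ k : ℝ → ℝ≥0∞, Measurable k →
      ∫⁻ x, k x = ⨆ m : ℕ, ∫⁻ x, min (k x) (m : ℝ≥0∞) := by
    intro k hk
    rw [← lintegral_iSup (fun m => hk.min measurable_const)]
    · simp only [iSup_min_natCast]
    · exact fun m m' hm x => min_le_min_left _ (by exact_mod_cast hm)
  have hmono : ∀ k : ℝ → ℝ≥0∞, Monotone fun m : ℕ => ∫⁻ x, min (k x) (m : ℝ≥0∞) :=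
    fun k m m' hm => lintegral_mono fun x => min_le_min_left _ (by exact_mod_cast hm)
  rw [hint f hf, hint g hg, ENNReal.iSup_mul]
  simp_rw [ENNReal.mul_iSup]
  refine iSup_le fun i => iSup_le fun j => ?_
  refine (mul_le_mul' (hmono f (le_max_left i j)) (hmono g (le_max_right i j))).trans ?_
  set m := max i j
  have hb : ∀ k : ℝ → ℝ≥0∞, ⨆ x, min (k x) (m : ℝ≥0∞) ≠ ⊤ := fun k =>
    ne_top_of_le_ne_top (ENNReal.natCast_ne_top m) (iSup_le fun x => min_le_right _ _)
  refine lintegral_mul_le_sq_of_iSup_ne_top (hf.min measurable_const)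
    (hg.min measurable_const) hh (hb f) (hb g) fun x y => le_trans ?_ (H x y)
  exact mul_le_mul' (min_le_left _ _) (min_le_left _ _)

theorem SatisfiesPrekopaLeindler.prod {E F : Type*} [AddCommGroup E] [Module ℝ E]
    [MeasurableSpace E] [AddCommGroup F] [Module ℝ F] [MeasurableSpace F] {μ : Measure E}
    {ν : Measure F} [SFinite μ] [SFinite ν] (hμ : SatisfiesPrekopaLeindler μ)
    (hν : SatisfiesPrekopaLeindler ν) : SatisfiesPrekopaLeindler (μ.prod ν) := by
  intro f g h hf hg hh H
  rw [lintegral_prod _ hf.aemeasurable, lintegral_prod _ hg.aemeasurable,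
    lintegral_prod _ hh.aemeasurable]
  refine hμ _ _ _ hf.lintegral_prod_right' hg.lintegral_prod_right' hh.lintegral_prod_right'
    fun x x' => ?_
  exact hν _ _ _ (hf.comp measurable_prodMk_left) (hg.comp measurable_prodMk_left)
    (hh.comp measurable_prodMk_left) fun y y' => H (x, y) (x', y')

theorem SatisfiesPrekopaLeindler.of_measurePreserving {E F : Type*} [AddCommGroup E] [Module ℝ E]
    [MeasurableSpace E] [AddCommGroup F] [Module ℝ F] [MeasurableSpace F] {μ : Measure E}
    {ν : Measure F} (hν : SatisfiesPrekopaLeindler ν) (e : F ≃ᵐ E) (he : MeasurePreserving e ν μ)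
    (hadd : ∀ x y, e ((2:ℝ)⁻¹ • (x + y)) = (2:ℝ)⁻¹ • (e x + e y)) :
    SatisfiesPrekopaLeindler μ := by
  intro f g h hf hg hh H
  rw [← he.lintegral_comp hf, ← he.lintegral_comp hg, ← he.lintegral_comp hh]
  refine hν _ _ _ (hf.comp e.measurable) (hg.comp e.measurable) (hh.comp e.measurable)
    fun x y => ?_
  rw [hadd]
  exact H _ _

theorem satisfiesPrekopaLeindler_pi (n : ℕ) :
    SatisfiesPrekopaLeindler (volume : Measure (Fin n → ℝ)) := by
  induction n with
  | zero =>
    intro f g h hf hg hh H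
    have hv : (volume : Measure (Fin 0 → ℝ)) = Measure.dirac 0 := by
      rw [volume_pi, Measure.pi_of_empty _ 0]
    rw [hv, lintegral_dirac, lintegral_dirac, lintegral_dirac]
    simpa using H 0 0
  | succ n ih =>
    refine (satisfiesPrekopaLeindler_real.prod ih).of_measurePreserving
      (MeasurableEquiv.piFinSuccAbove (fun _ => ℝ) 0).symm
      (volume_preserving_piFinSuccAbove (fun _ => ℝ) 0).symm ?_
    rintro ⟨x, u⟩ ⟨y, v⟩
    ext i
    refine Fin.cases ?_ (fun j => ?_) i
    · simp [MeasurableEquiv.piFinSuccAbove]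
    · simp [MeasurableEquiv.piFinSuccAbove, mul_add]

theorem satisfiesPrekopaLeindler_euclideanSpace (n : ℕ) :
    SatisfiesPrekopaLeindler (volume : Measure (EuclideanSpace ℝ (Fin n))) :=
  (satisfiesPrekopaLeindler_pi n).of_measurePreserving
    (MeasurableEquiv.toLp 2 (Fin n → ℝ)) (PiLp.volume_preserving_toLp (Fin n)) fun _ _ => rfl

namespace IsSymmConvexBody

section NormedSpace

variable {E : Type*} [NormedAddCommGroup E] [NormedSpace ℝ E] {K : Set E}

lemma neg_mem_s6 (hK : IsSymmConvexBody K) {x : E} (hx : x ∈ K) : -x ∈ K := by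
  rw [hK.2.2.2]
  simpa using hx

lemma mem_nhds_zero_s6 (hK : IsSymmConvexBody K) : K ∈ 𝓝 (0:E) := by
  obtain ⟨-, hconv, ⟨x, hx⟩, hsymm⟩ := hK
  rw [← mem_interior_iff_mem_nhds]
  have hx' : -x ∈ interior K := by
    have h : -x ∈ -interior K := by simpa using hx
    have h2 : -interior K ⊆ interior K :=
      interior_maximal (fun y hy => by
        rw [hsymm]
        exact interior_subset (s := K) hy)
        isOpen_interior.neg
    exact h2 h
  have := hconv.interior hx hx' (a := 2⁻¹) (b := 2⁻¹) (by norm_num) (by norm_num) (by norm_num)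
  simpa using this

lemma gauge_le_one_iff_s6 (hK : IsSymmConvexBody K) {x : E} : gauge K x ≤ 1 ↔ x ∈ K := by
  rw [gauge_le_one_iff_mem_closure hK.2.1 hK.mem_nhds_zero_s6, hK.1.isClosed.closure_eq]

lemma continuous_gauge (hK : IsSymmConvexBody K) : Continuous (gauge K) :=
  _root_.continuous_gauge hK.2.1 hK.mem_nhds_zero_s6

lemma gauge_pos (hK : IsSymmConvexBody K) {x : E} (hx : x ≠ 0) : 0 < gauge K x :=
  (_root_.gauge_pos (absorbent_nhds_zero hK.mem_nhds_zero_s6)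
    (NormedSpace.isVonNBounded_of_isBounded ℝ hK.1.isBounded)).2 hx

lemma mem_smul_of_gauge_le_s6 (hK : IsSymmConvexBody K) {x : E} {r : ℝ} (hr : 0 ≤ r)
    (hx : gauge K x ≤ r) : x ∈ r • K := by
  rcases eq_or_ne x 0 with rfl | hx0
  · exact ⟨0, mem_of_mem_nhds hK.mem_nhds_zero_s6, smul_zero r⟩
  have hr' : 0 < r := (hK.gauge_pos hx0).trans_le hx
  rw [Set.mem_smul_set_iff_inv_smul_mem₀ hr'.ne', ← hK.gauge_le_one_iff_s6,
    gauge_smul_of_nonneg (inv_nonneg.2 hr), smul_eq_mul, inv_mul_le_iff₀ hr', mul_one]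
  exact hx

end NormedSpace

variable {n : ℕ} {K : Set (EuclideanSpace ℝ (Fin n))}

lemma bddAbove_inner (hK : IsSymmConvexBody K) (θ : EuclideanSpace ℝ (Fin n)) :
    BddAbove ((fun y => ⟪θ, y⟫) '' K) :=
  (hK.1.image (by fun_prop)).bddAbove

lemma inner_le_dualNorm (hK : IsSymmConvexBody K) (θ : EuclideanSpace ℝ (Fin n))
    {x : EuclideanSpace ℝ (Fin n)} (hx : x ∈ K) : ⟪x, θ⟫ ≤ dualNorm K θ := by
  rw [real_inner_comm]
  exact le_csSup (hK.bddAbove_inner θ) ⟨x, hx, rfl⟩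

lemma abs_inner_le_dualNorm (hK : IsSymmConvexBody K) (θ : EuclideanSpace ℝ (Fin n))
    {x : EuclideanSpace ℝ (Fin n)} (hx : x ∈ K) : |⟪x, θ⟫| ≤ dualNorm K θ := by
  refine abs_le'.2 ⟨hK.inner_le_dualNorm θ hx, ?_⟩
  simpa using hK.inner_le_dualNorm θ (hK.neg_mem_s6 hx)

lemma exists_inner_eq_dualNorm (hK : IsSymmConvexBody K) (θ : EuclideanSpace ℝ (Fin n)) :
    ∃ y ∈ K, ⟪y, θ⟫ = dualNorm K θ := by
  obtain ⟨y, hy, h⟩ := (hK.1.image (f := fun y => ⟪θ, y⟫) (by fun_prop)).sSup_mem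
    ((hK.2.2.1.mono interior_subset).image _)
  exact ⟨y, hy, by rw [real_inner_comm]; exact h⟩

lemma abs_inner_le_gauge_mul_dualNorm (hK : IsSymmConvexBody K) (θ x : EuclideanSpace ℝ (Fin n)) :
    |⟪x, θ⟫| ≤ gauge K x * dualNorm K θ := by
  obtain ⟨y, hy, hyx⟩ := hK.mem_smul_of_gauge_le_s6 (gauge_nonneg x) le_rfl
  have hx : ⟪x, θ⟫ = gauge K x * ⟪y, θ⟫ := by
    rw [← real_inner_smul_left]
    exact congrArg (⟪·, θ⟫) hyx.symm
  rw [hx, abs_mul, abs_of_nonneg (gauge_nonneg x)]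
  exact mul_le_mul_of_nonneg_left (hK.abs_inner_le_dualNorm θ hy) (gauge_nonneg x)

lemma dualNorm_pos (hK : IsSymmConvexBody K) {θ : EuclideanSpace ℝ (Fin n)} (hθ : θ ≠ 0) :
    0 < dualNorm K θ := by
  have h := hK.abs_inner_le_gauge_mul_dualNorm θ θ
  rw [real_inner_self_eq_norm_sq, abs_of_nonneg (by positivity)] at h
  have h1 : 0 < ‖θ‖ ^ 2 := by positivity
  exact pos_of_mul_pos_right (h1.trans_le h) (gauge_nonneg θ)

lemma volume_ne_top (hK : IsSymmConvexBody K) : volume K ≠ ⊤ := hK.1.measure_lt_top.ne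

lemma volume_ne_zero (hK : IsSymmConvexBody K) : volume K ≠ 0 :=
  (Measure.measure_pos_of_mem_nhds volume hK.mem_nhds_zero_s6).ne'

lemma integrableOn_exp (hK : IsSymmConvexBody K) (θ : EuclideanSpace ℝ (Fin n)) (l : ℝ) :
    IntegrableOn (fun x => Real.exp (⟪x, θ⟫ ^ 2 / l ^ 2)) K :=
  ContinuousOn.integrableOn_compact hK.1 (by fun_prop)

lemma volume_setOf_le_one_sub_gauge (hK : IsSymmConvexBody K) {t : ℝ} :
    volume.restrict K {x | t ≤ 1 - gauge K x} ≤
      ENNReal.ofReal (Real.exp (-(n * t))) * volume K := by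
  refine (Measure.restrict_apply_le _ _).trans ?_
  rcases lt_or_ge 1 t with ht | ht
  · have : {x | t ≤ 1 - gauge K x} = ∅ := by
      ext x
      have := gauge_nonneg (s := K) x
      simp only [Set.mem_ofPred_eq, Set.mem_empty_iff_false, iff_false]
      linarith
    simp [this]
  have hsub : {x | t ≤ 1 - gauge K x} ⊆ (1 - t) • K := fun x (hx : t ≤ _) =>
    hK.mem_smul_of_gauge_le_s6 (by linarith) (by linarith)
  refine (measure_mono hsub).trans ?_
  rw [Measure.addHaar_smul, finrank_euclideanSpace_fin]
  gcongr
  rw [abs_of_nonneg (pow_nonneg (by linarith) _), neg_mul_eq_mul_neg, Real.exp_nat_mul]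
  gcongr
  linarith [Real.add_one_le_exp (-t)]

lemma lintegral_exp_one_sub_gauge_le (hK : IsSymmConvexBody K) (hn : 0 < n) :
    ∫⁻ x in K, ENNReal.ofReal (Real.exp (n / 2 * (1 - gauge K x))) ≤ 2 * volume K := by
  set β : ℝ := n / 2 with hβ
  have hβ0 : 0 < β := by positivity
  have hlayer := lintegral_comp_eq_lintegral_meas_le_mul (volume.restrict K)
    (f := fun x => 1 - gauge K x) (g := fun t => β * Real.exp (β * t))
    ((ae_restrict_iff' hK.1.measurableSet).2 (Filter.Eventually.of_forall fun x hx =>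
      sub_nonneg.2 (hK.gauge_le_one_iff_s6.2 hx)))
    (continuous_const.sub hK.continuous_gauge).aemeasurable
    (fun t _ => Continuous.intervalIntegrable (by fun_prop) _ _)
    (Filter.Eventually.of_forall fun t => by positivity)
  have hftc : ∀ s : ℝ, ∫ t in (0:ℝ)..s, β * Real.exp (β * t) = Real.exp (β * s) - 1 := by
    intro s
    rw [intervalIntegral.integral_eq_sub_of_hasDerivAt (f := fun t => Real.exp (β * t))]
    · simp
    · intro t _
      simpa [mul_comm] using ((hasDerivAt_id t).const_mul β).exp
    · exact Continuous.intervalIntegrable (by fun_prop) _ _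
  simp only [hftc] at hlayer
  have htail : ∫⁻ t in Set.Ioi (0:ℝ), volume.restrict K {x | t ≤ 1 - gauge K x} *
      ENNReal.ofReal (β * Real.exp (β * t)) ≤ volume K := by
    calc _ ≤ ∫⁻ t in Set.Ioi (0:ℝ),
          volume K * ENNReal.ofReal (β * Real.exp (-β * t)) := by
          refine lintegral_mono fun t => ?_
          refine (mul_le_mul_left (hK.volume_setOf_le_one_sub_gauge (t := t)) _).trans_eq ?_
          rw [mul_comm (ENNReal.ofReal _), mul_assoc, ← ENNReal.ofReal_mul (by positivity),
            mul_left_comm, ← Real.exp_add]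
          congr 4
          rw [hβ]; ring
      _ = volume K := by
          rw [lintegral_const_mul _ (by fun_prop), ← ofReal_integral_eq_lintegral_ofReal,
            integral_const_mul, integral_exp_mul_Ioi (by linarith)]
          · simp [hβ0.ne']
          · exact (exp_neg_integrableOn_Ioi 0 hβ0).const_mul β
          · exact Filter.Eventually.of_forall fun t => by positivity
  calc ∫⁻ x in K, ENNReal.ofReal (Real.exp (β * (1 - gauge K x)))
      = ∫⁻ x in K, (ENNReal.ofReal (Real.exp (β * (1 - gauge K x)) - 1) + 1) := by
        refine setLIntegral_congr_fun hK.1.measurableSet fun x hx => ?_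
        have h1 : 0 ≤ 1 - gauge K x := sub_nonneg.2 (hK.gauge_le_one_iff_s6.2 hx)
        have h2 : 1 ≤ Real.exp (β * (1 - gauge K x)) := Real.one_le_exp (by positivity)
        rw [← ENNReal.ofReal_one, ← ENNReal.ofReal_add (by linarith) zero_le_one,
          sub_add_cancel]
    _ ≤ volume K + volume K := by
        rw [lintegral_add_right _ measurable_const, hlayer]
        simpa using add_le_add_left htail (volume K)
    _ = 2 * volume K := (two_mul _).symm

lemma gauge_midpoint_le (hK : IsSymmConvexBody K) {α : ℝ} (h2 : IsTwoConvex K α)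
    {x y : EuclideanSpace ℝ (Fin n)} (hx : x ∈ K) (hy : y ∈ K) :
    α * gauge K (x - y) ^ 2 ≤ 1 - gauge K ((2:ℝ)⁻¹ • (x + y)) := by
  have hmid : (2:ℝ)⁻¹ • (x + y) ∈ K := by
    rw [smul_add]
    exact hK.2.1 hx hy (by norm_num) (by norm_num) (by norm_num)
  rcases (gauge_nonneg (s := K) (x - y)).eq_or_lt with h0 | h0
  · rw [← h0]
    simpa using hK.gauge_le_one_iff_s6.2 hmid
  have hx1 := hK.gauge_le_one_iff_s6.2 hx
  have hy1 := hK.gauge_le_one_iff_s6.2 hy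
  have hle : gauge K (x - y) ≤ 2 := by
    have h3 := gauge_add_le hK.2.1 (absorbent_nhds_zero hK.mem_nhds_zero_s6) x (-y)
    have h4 := hK.gauge_le_one_iff_s6.2 (hK.neg_mem_s6 hy)
    rw [← sub_eq_add_neg] at h3
    linarith
  refine (h2 _ h0 hle).trans (csInf_le ⟨0, ?_⟩ ⟨x, y, hx1, hy1, le_rfl, rfl⟩)
  rintro d ⟨u, v, hu, hv, -, rfl⟩
  refine sub_nonneg.2 (hK.gauge_le_one_iff_s6.2 ?_)
  rw [smul_add]
  exact hK.2.1 (hK.gauge_le_one_iff_s6.1 hu) (hK.gauge_le_one_iff_s6.1 hv)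
    (by norm_num) (by norm_num) (by norm_num)

lemma lintegral_exp_sq_le (hK : IsSymmConvexBody K) {α : ℝ} (hα : 0 < α) (h2 : IsTwoConvex K α)
    (hn : 0 < n) {θ : EuclideanSpace ℝ (Fin n)} (hθ : θ ≠ 0) :
    ∫⁻ x in K, ENNReal.ofReal (Real.exp (α * n / dualNorm K θ ^ 2 * ⟪x, θ⟫ ^ 2)) ≤
      4 * volume K := by
  have hh := hK.dualNorm_pos hθ
  set H := dualNorm K θ with hH
  set c : ℝ := α * n / H ^ 2 with hc
  have hc0 : 0 ≤ c := by positivity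
  have hKm := hK.1.measurableSet
  set φ : EuclideanSpace ℝ (Fin n) → ℝ≥0∞ := fun x => ENNReal.ofReal (Real.exp (c * ⟪x, θ⟫ ^ 2))
    with hφ
  have hφm : Measurable φ := by fun_prop
  set P : Set (EuclideanSpace ℝ (Fin n)) := K ∩ {x | 0 ≤ ⟪x, θ⟫} with hP
  set f := P.indicator φ with hf
  set Z := K.indicator fun x => ENNReal.ofReal (Real.exp (n / 2 * (1 - gauge K x))) with hZ
  have hPm : MeasurableSet P :=
    hKm.inter (isClosed_le continuous_const (by fun_prop)).measurableSet
  have hfm : Measurable f := hφm.indicator hPm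
  have hZm : Measurable Z := by
    refine Measurable.indicator ?_ hKm
    have := hK.continuous_gauge.measurable
    fun_prop
  have hPL := satisfiesPrekopaLeindler_euclideanSpace n f (fun x => f (-x)) Z hfm
    (hfm.comp measurable_neg) hZm (by
      intro x y
      by_cases hx : x ∈ P
      swap
      · simp [hf, hx]
      by_cases hy : -y ∈ P
      swap
      · simp [hf, hy]
      have hyK : y ∈ K := by simpa using hK.neg_mem_s6 hy.1
      have hmid : (2:ℝ)⁻¹ • (x + y) ∈ K := by
        rw [smul_add]
        exact hK.2.1 hx.1 hyK (by norm_num) (by norm_num) (by norm_num)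
      rw [hf, hZ, Set.indicator_of_mem hx, Set.indicator_of_mem hy, Set.indicator_of_mem hmid,
        ← ENNReal.ofReal_pow (by positivity), ← ENNReal.ofReal_mul (by positivity),
        ← Real.exp_add, ← Real.exp_nat_mul]
      refine ENNReal.ofReal_le_ofReal (Real.exp_le_exp.2 ?_)
      have hu : 0 ≤ ⟪x, θ⟫ := hx.2
      have hv : 0 ≤ ⟪-y, θ⟫ := hy.2
      have hdist := hK.abs_inner_le_gauge_mul_dualNorm θ (x - y)
      have hconv := hK.gauge_midpoint_le h2 hx.1 hyK
      have hsq : (⟪x, θ⟫ + ⟪-y, θ⟫) ^ 2 ≤ (gauge K (x - y) * H) ^ 2 := by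
        refine pow_le_pow_left₀ (add_nonneg hu hv) ?_ 2
        refine le_trans (le_of_eq ?_) ((le_abs_self _).trans hdist)
        rw [← inner_add_left, sub_eq_add_neg]
      calc c * ⟪x, θ⟫ ^ 2 + c * ⟪-y, θ⟫ ^ 2
          ≤ c * (gauge K (x - y) * H) ^ 2 := by
            rw [← mul_add]
            refine mul_le_mul_of_nonneg_left (le_trans ?_ hsq) hc0
            nlinarith [mul_nonneg hu hv]
        _ = n * (α * gauge K (x - y) ^ 2) := by
            rw [hc]; field_simp
        _ ≤ n * (1 - gauge K ((2:ℝ)⁻¹ • (x + y))) := by gcongr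
        _ = _ := by push_cast; ring)
  have hneg : ∫⁻ x, f (-x) = ∫⁻ x, f x :=
    (Measure.measurePreserving_neg volume).lintegral_comp hfm
  rw [hneg, ← sq] at hPL
  have hfZ : ∫⁻ x, f x ≤ 2 * volume K := by
    refine ((ENNReal.pow_le_pow_left_iff two_ne_zero).1 hPL).trans ?_
    rw [hZ, lintegral_indicator hKm]
    exact hK.lintegral_exp_one_sub_gauge_le hn
  calc ∫⁻ x in K, φ x = ∫⁻ x, K.indicator φ x := (lintegral_indicator hKm _).symm
    _ ≤ ∫⁻ x, (f x + f (-x)) := by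
        refine lintegral_mono fun x => ?_
        by_cases hx : x ∈ K
        swap
        · simp [hx]
        rw [Set.indicator_of_mem hx]
        rcases le_total 0 ⟪x, θ⟫ with hu | hu
        · rw [hf, Set.indicator_of_mem (show x ∈ P from ⟨hx, hu⟩)]
          exact le_self_add
        · have hx' : -x ∈ P := ⟨hK.neg_mem_s6 hx, by simpa using hu⟩
          rw [hf, Set.indicator_of_mem hx']
          refine le_trans (le_of_eq ?_) le_add_self
          simp [hφ]
    _ = (∫⁻ x, f x) + ∫⁻ x, f x := by rw [lintegral_add_left hfm, hneg]
    _ ≤ 2 * volume K + 2 * volume K := add_le_add hfZ hfZ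
    _ = 4 * volume K := by rw [← add_mul]; norm_num

lemma integral_exp_sq_le (hK : IsSymmConvexBody K) {α : ℝ} (hα : 0 < α) (h2 : IsTwoConvex K α)
    (hn : 0 < n) {θ : EuclideanSpace ℝ (Fin n)} (hθ : θ ≠ 0) {l : ℝ}
    (hl : l ^ 2 = 2 * dualNorm K θ ^ 2 / (α * n)) :
    (volume K).toReal⁻¹ * ∫ x in K, Real.exp (⟪x, θ⟫ ^ 2 / l ^ 2) ≤ 2 := by
  have hh := hK.dualNorm_pos hθ
  have hV : 0 < (volume K).toReal := ENNReal.toReal_pos hK.volume_ne_zero hK.volume_ne_top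
  set c : ℝ := α * n / dualNorm K θ ^ 2 with hc
  have hint : IntegrableOn (fun x => Real.exp (c * ⟪x, θ⟫ ^ 2)) K :=
    ContinuousOn.integrableOn_compact hK.1 (by fun_prop)
  have hI : ∫ x in K, Real.exp (c * ⟪x, θ⟫ ^ 2) ≤ 4 * (volume K).toReal := by
    have h := hK.lintegral_exp_sq_le hα h2 hn hθ
    rw [← ofReal_integral_eq_lintegral_ofReal hint
      (Filter.Eventually.of_forall fun x => by positivity)] at h
    have h4 : (4 : ℝ≥0∞) * volume K ≠ ⊤ := ENNReal.mul_ne_top (by norm_num) hK.volume_ne_top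
    have h5 := (ENNReal.ofReal_le_iff_le_toReal h4).1 h
    simpa using h5
  have hle : ∫ x in K, Real.exp (⟪x, θ⟫ ^ 2 / l ^ 2) ≤
      ∫ x in K, (4⁻¹ * Real.exp (c * ⟪x, θ⟫ ^ 2) + 1) := by
    refine integral_mono (hK.integrableOn_exp θ l)
      ((hint.const_mul _).add (integrableOn_const hK.volume_ne_top)) fun x => ?_
    have he : c * ⟪x, θ⟫ ^ 2 = ⟪x, θ⟫ ^ 2 / l ^ 2 + ⟪x, θ⟫ ^ 2 / l ^ 2 := by
      rw [hl, hc]; field_simp; ring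
    simp only
    rw [he, Real.exp_add]
    nlinarith [sq_nonneg (Real.exp (⟪x, θ⟫ ^ 2 / l ^ 2) - 2)]
  rw [integral_add (hint.const_mul _) (integrableOn_const hK.volume_ne_top), integral_const_mul,
    setIntegral_const, smul_eq_mul, mul_one, measureReal_def] at hle
  rw [inv_mul_le_iff₀ hV]
  linarith

lemma dualNorm_sq_le (hK : IsSymmConvexBody K) (hn : 0 < n) (θ : EuclideanSpace ℝ (Fin n))
    {l : ℝ} (hl : 0 < l)
    (hint : (volume K).toReal⁻¹ * ∫ x in K, Real.exp (⟪x, θ⟫ ^ 2 / l ^ 2) ≤ 2) :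
    dualNorm K θ ^ 2 ≤ 12 * n * l ^ 2 := by
  have hV : 0 < (volume K).toReal := ENNReal.toReal_pos hK.volume_ne_zero hK.volume_ne_top
  obtain ⟨y, hy, hyH⟩ := hK.exists_inner_eq_dualNorm θ
  set H := dualNorm K θ with hH
  have hH0 : 0 ≤ H := (abs_nonneg _).trans (hK.abs_inner_le_dualNorm θ hy)
  set T := ((3 / 4 : ℝ) • y) +ᵥ ((4:ℝ)⁻¹ • K) with hT
  have hTK : T ⊆ K := by
    rintro _ ⟨_, ⟨x, hx, rfl⟩, rfl⟩
    exact hK.2.1 hy hx (by norm_num) (by norm_num) (by norm_num)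
  have hTH : ∀ z ∈ T, H / 2 ≤ ⟪z, θ⟫ := by
    rintro _ ⟨_, ⟨x, hx, rfl⟩, rfl⟩
    have := (abs_le.1 (hK.abs_inner_le_dualNorm θ hx)).1
    simp only [vadd_eq_add, inner_add_left, real_inner_smul_left, hyH]
    linarith
  have hTm : MeasurableSet T := ((hK.1.smul _).vadd _).measurableSet
  have hTV : volume.real T = (4⁻¹) ^ n * (volume K).toReal := by
    rw [measureReal_def, hT, measure_vadd, Measure.addHaar_smul, finrank_euclideanSpace_fin,
      ENNReal.toReal_mul, ENNReal.toReal_ofReal (abs_nonneg _), abs_of_nonneg (by positivity)]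
  have hlow : (4⁻¹) ^ n * (volume K).toReal * Real.exp (H ^ 2 / 4 / l ^ 2) ≤
      ∫ x in K, Real.exp (⟪x, θ⟫ ^ 2 / l ^ 2) := by
    calc _ = ∫ x in T, Real.exp (H ^ 2 / 4 / l ^ 2) := by
          rw [setIntegral_const, smul_eq_mul, hTV]
      _ ≤ ∫ x in T, Real.exp (⟪x, θ⟫ ^ 2 / l ^ 2) := by
          refine setIntegral_mono_on
            (integrableOn_const (ne_top_of_le_ne_top hK.volume_ne_top (measure_mono hTK)))
            ((hK.integrableOn_exp θ l).mono_set hTK) hTm fun x hx => ?_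
          gcongr
          nlinarith [hTH x hx]
      _ ≤ _ := setIntegral_mono_set (hK.integrableOn_exp θ l)
          (Filter.Eventually.of_forall fun x => (Real.exp_pos _).le) hTK.eventuallyLE
  rw [inv_mul_le_iff₀ hV] at hint
  have h1 : Real.exp (H ^ 2 / 4 / l ^ 2) ≤ 2 * 4 ^ n := by
    have h := hlow.trans hint
    rw [inv_pow, mul_assoc, inv_mul_le_iff₀ (by positivity), mul_left_comm,
      mul_le_mul_iff_right₀ hV] at h
    linarith
  have h2 : (2:ℝ) * 4 ^ n ≤ Real.exp (n * 3) := by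
    have he : (2:ℝ) ≤ Real.exp 1 := by linarith [Real.add_one_le_exp (1:ℝ)]
    have he3 : (8:ℝ) ≤ Real.exp 3 := by
      have : Real.exp 3 = Real.exp 1 ^ 3 := by rw [← Real.exp_nat_mul]; norm_num
      rw [this]
      calc (8:ℝ) = 2 ^ 3 := by norm_num
        _ ≤ _ := by gcongr
    calc (2:ℝ) * 4 ^ n ≤ 2 ^ n * 4 ^ n := by
          gcongr
          exact le_self_pow₀ one_le_two hn.ne'
      _ = 8 ^ n := by rw [← mul_pow]; norm_num
      _ ≤ Real.exp 3 ^ n := by gcongr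
      _ = _ := by rw [← Real.exp_nat_mul]
  have h3 := Real.exp_le_exp.1 (h1.trans h2)
  rw [div_le_iff₀ (by positivity)] at h3
  linarith

end IsSymmConvexBody

theorem twoConvex_psiTwo_norm_bounds :
    ∃ C₁ C₂ : ℝ, 0 < C₁ ∧ 0 < C₂ ∧
      ∀ (n : ℕ) (K : Set (EuclideanSpace ℝ (Fin n))) (α : ℝ)
        (θ : EuclideanSpace ℝ (Fin n)),
        0 < n → IsSymmConvexBody K → 0 < α → IsTwoConvex K α → ‖θ‖ = 1 →
        C₁ * dualNorm K θ / Real.sqrt n ≤ psiTwoNorm K θ ∧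
        psiTwoNorm K θ ≤ C₂ * dualNorm K θ / (Real.sqrt α * Real.sqrt n) := by
  refine ⟨1 / 4, Real.sqrt 2, by norm_num, by positivity, ?_⟩
  intro n K α θ hn hK hα h2 hθ
  have hθ0 : θ ≠ 0 := by
    rintro rfl
    simp at hθ
  have hh := hK.dualNorm_pos hθ0
  have hn0 : (0:ℝ) < n := by exact_mod_cast hn
  have hmem : Real.sqrt 2 * dualNorm K θ / (Real.sqrt α * Real.sqrt n) ∈ { l : ℝ | 0 < l ∧
      (volume K).toReal⁻¹ * ∫ x in K, Real.exp (⟪x, θ⟫ ^ 2 / l ^ 2) ≤ 2 } := by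
    refine ⟨by positivity, hK.integral_exp_sq_le hα h2 hn hθ0 ?_⟩
    rw [div_pow, mul_pow, mul_pow, Real.sq_sqrt zero_le_two, Real.sq_sqrt hα.le,
      Real.sq_sqrt hn0.le]
  refine ⟨le_csInf ⟨_, hmem⟩ ?_, csInf_le ⟨0, fun l hl => hl.1.le⟩ hmem⟩
  rintro l ⟨hl, hint⟩
  have hsq := hK.dualNorm_sq_le hn θ hl hint
  rw [div_le_iff₀ (by positivity)]
  have : dualNorm K θ ≤ 4 * (l * Real.sqrt n) := by
    refine (sq_le_sq₀ hh.le (by positivity)).1 ?_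
    rw [mul_pow, mul_pow, Real.sq_sqrt hn0.le]
    nlinarith [mul_nonneg hn0.le (sq_nonneg l)]
  linarith
end
end
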